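/- Assume b = A x̄ + z, let δ' ∈ (0,1), γ > (1+δ')/(1−δ'), and λ > 0 satisfy λ ≥ max{4, (γ+1)/((1−δ')γ − (1+δ'))} · ‖Aᵀz‖_∞, let Γ_u > 1 and s̃ ≥ 1 be an integer with ρ₋(A, s̄+2s̃) > 0 and s̃ > 16(Γ_u ρ₊(A, s̄+2s̃) + 2ρ₊(A, s̃)) (1+γ) s̄ / ρ₋(A, s̄+s̃). Let x : ℕ → ℝⁿ and M : ℕ → ℝ satisfy: x(k+1) = T_{λ,M(k)}(x(k)) with 0 < M(k) ≤ Γ_u ρ₊(A, s̄+2s̃) and φ_λ(x(k+1)) ≤ ψ_{λ,M(k)}(x(k); x(k+1)) for all k; and suppose ‖x(0)_{S̄ᶜ}‖₀ ≤ s̃ and ω_λ(x(0)) ≤ δ'λ. Then φ_λ attains its minimum at some x* with ‖x*_{S̄ᶜ}‖₀ ≤ s̃, and for all k ≥ 0: ‖x(k)_{S̄ᶜ}‖₀ ≤ s̃ and φ_λ(x(k)) − φ_λ(x*) ≤ (1 − 1/(4Γ_u κ))^k · (φ_λ(x(0)) − φ_λ(x*)), where κ = ρ₊(A, s̄+2s̃)/ρ₋(A,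 s̄+2s̃). -/

import Mathlib

open scoped BigOperators
open Matrix

noncomputable section

namespace PGH

/-- Euclidean dot product on `Fin n → ℝ`. -/
def dot {n : ℕ} (x y : Fin n → ℝ) : ℝ := ∑ i, x i * y i

/-- Squared Euclidean norm. -/
def sqnorm {n : ℕ} (x : Fin n → ℝ) : ℝ := ∑ i, (x i) ^ 2

/-- Euclidean (ℓ₂) norm. -/
noncomputable def l2 {n : ℕ} (x : Fin n → ℝ) : ℝ := Real.sqrt (sqnorm x)

/-- ℓ₁ norm. -/
def l1 {n : ℕ} (x : Fin n → ℝ) : ℝ := ∑ i, |x i|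

/-- ℓ∞ norm (maximum absolute coordinate). -/
noncomputable def linf {n : ℕ} (x : Fin n → ℝ) : ℝ := ⨆ i, |x i|

/-- Support of a vector. -/
def supp {n : ℕ} (x : Fin n → ℝ) : Finset (Fin n) := Finset.univ.filter (fun i => x i ≠ 0)

/-- Number of nonzero coordinates. -/
def l0 {n : ℕ} (x : Fin n → ℝ) : ℕ := (supp x).card

/-- Number of nonzero coordinates within the index set `S`
(i.e. `‖x_S‖₀` for the restriction of `x` to `S`). -/
def l0on {n : ℕ} (S : Finset (Fin n)) (x : Fin n → ℝ) : ℕ :=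
  (S.filter (fun i => x i ≠ 0)).card

/-- ℓ₁ norm of the restriction of `x` to the index set `S`. -/
def l1on {n : ℕ} (S : Finset (Fin n)) (x : Fin n → ℝ) : ℝ := ∑ i ∈ S, |x i|

/-- Gradient of `f(x) = (1/2)‖Ax - b‖₂²`, namely `Aᵀ(Ax - b)`. -/
def grad {m n : ℕ} (A : Matrix (Fin m) (Fin n) ℝ) (b : Fin m → ℝ) (x : Fin n → ℝ) :
    Fin n → ℝ :=
  Aᵀ.mulVec (A.mulVec x - b)

/-- Least-squares objective `f(x) = (1/2)‖Ax - b‖₂²`. -/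
def fls {m n : ℕ} (A : Matrix (Fin m) (Fin n) ℝ) (b : Fin m → ℝ) (x : Fin n → ℝ) : ℝ :=
  sqnorm (A.mulVec x - b) / 2

/-- ℓ₁-regularized least-squares objective `φ_λ(x) = f(x) + λ‖x‖₁`. -/
def phi {m n : ℕ} (A : Matrix (Fin m) (Fin n) ℝ) (b : Fin m → ℝ) (lam : ℝ)
    (x : Fin n → ℝ) : ℝ :=
  fls A b x + lam * l1 x

/-- Restricted maximal eigenvalue `ρ₊(A, s)`. -/
noncomputable def rhoPlus {m n : ℕ} (A : Matrix (Fin m) (Fin n) ℝ) (s : ℕ) : ℝ :=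
  sSup {r | ∃ x : Fin n → ℝ, x ≠ 0 ∧ l0 x ≤ s ∧ r = sqnorm (A.mulVec x) / sqnorm x}

/-- Restricted minimal eigenvalue `ρ₋(A, s)`. -/
noncomputable def rhoMinus {m n : ℕ} (A : Matrix (Fin m) (Fin n) ℝ) (s : ℕ) : ℝ :=
  sInf {r | ∃ x : Fin n → ℝ, x ≠ 0 ∧ l0 x ≤ s ∧ r = sqnorm (A.mulVec x) / sqnorm x}

/-- `ξ` is a subgradient of the ℓ₁ norm at `x`. -/
def IsSubgrad {n : ℕ} (x ξ : Fin n → ℝ) : Prop :=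
  ∀ i, (x i ≠ 0 → ξ i = Real.sign (x i)) ∧ (x i = 0 → |ξ i| ≤ 1)

/-- Optimality residue `ω_λ(x) = min_{ξ ∈ ∂‖x‖₁} ‖Aᵀ(Ax−b) + λξ‖_∞`. -/
noncomputable def omega {m n : ℕ} (A : Matrix (Fin m) (Fin n) ℝ) (b : Fin m → ℝ)
    (lam : ℝ) (x : Fin n → ℝ) : ℝ :=
  sInf {r | ∃ ξ : Fin n → ℝ, IsSubgrad x ξ ∧
    r = linf (fun i => grad A b x i + lam * ξ i)}

/-- The local model `ψ_{λ,L}(y; x)`. -/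
def psi {m n : ℕ} (A : Matrix (Fin m) (Fin n) ℝ) (b : Fin m → ℝ) (lam L : ℝ)
    (y x : Fin n → ℝ) : ℝ :=
  fls A b y + dot (grad A b y) (x - y) + L / 2 * sqnorm (x - y) + lam * l1 x

/-- The noise-domination condition
`λ ≥ max{4, (γ+1)/((1−δ')γ−(1+δ'))} ⬝ ‖Aᵀz‖_∞`. -/
def noiseCond {m n : ℕ} (A : Matrix (Fin m) (Fin n) ℝ) (z : Fin m → ℝ)
    (dp gam lam : ℝ) : Prop :=
  lam ≥ max 4 ((gam + 1) / ((1 - dp) * gam - (1 + dp))) * linf (Aᵀ.mulVec z)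

lemma sqnorm_nonneg {n : ℕ} (x : Fin n → ℝ) : 0 ≤ sqnorm x :=
  Finset.sum_nonneg (fun i _ => sq_nonneg (x i))

lemma sqnorm_pos {n : ℕ} {x : Fin n → ℝ} (h : x ≠ 0) : 0 < sqnorm x := by
  obtain ⟨i, hi⟩ := Function.ne_iff.mp h
  have hi' : x i ≠ 0 := hi
  refine Finset.sum_pos' (fun i _ => sq_nonneg (x i)) ⟨i, Finset.mem_univ i, by positivity⟩

lemma sqnorm_smul {n : ℕ} (a : ℝ) (x : Fin n → ℝ) : sqnorm (a • x) = a ^ 2 * sqnorm x := by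
  simp [sqnorm, Finset.mul_sum, mul_pow]

lemma sqnorm_sub_comm {n : ℕ} (x y : Fin n → ℝ) : sqnorm (x - y) = sqnorm (y - x) := by
  unfold sqnorm
  refine Finset.sum_congr rfl (fun i _ => ?_)
  simp only [Pi.sub_apply]; ring

lemma sqnorm_add {n : ℕ} (x y : Fin n → ℝ) :
    sqnorm (x + y) = sqnorm x + 2 * dot x y + sqnorm y := by
  simp only [sqnorm, dot, Finset.mul_sum, ← Finset.sum_add_distrib]
  refine Finset.sum_congr rfl (fun i _ => ?_)
  simp only [Pi.add_apply]; ring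

lemma dot_transpose {m n : ℕ} (A : Matrix (Fin m) (Fin n) ℝ) (r : Fin m → ℝ) (v : Fin n → ℝ) :
    dot (Aᵀ.mulVec r) v = dot r (A.mulVec v) := by
  change (Aᵀ.mulVec r) ⬝ᵥ v = r ⬝ᵥ (A.mulVec v)
  rw [Matrix.mulVec_transpose, Matrix.dotProduct_mulVec]

lemma dot_smul_right {n : ℕ} (a : ℝ) (x y : Fin n → ℝ) : dot x (a • y) = a * dot x y := by
  simp only [dot, Finset.mul_sum, Pi.smul_apply, smul_eq_mul]
  exact Finset.sum_congr rfl (fun i _ => by ring)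

lemma dot_sq_le {n : ℕ} (x y : Fin n → ℝ) : (dot x y) ^ 2 ≤ sqnorm x * sqnorm y :=
  Finset.sum_mul_sq_le_sq_mul_sq Finset.univ x y

lemma fls_expand {m n : ℕ} (A : Matrix (Fin m) (Fin n) ℝ) (b : Fin m → ℝ) (u y : Fin n → ℝ) :
    fls A b u = fls A b y + dot (grad A b y) (u - y) + sqnorm (A.mulVec (u - y)) / 2 := by
  have h : A.mulVec u - b = (A.mulVec y - b) + A.mulVec (u - y) := by
    rw [Matrix.mulVec_sub]; abel
  unfold fls grad
  rw [h, sqnorm_add, dot_transpose]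
  ring

lemma sqnorm_mulVec_le {m n : ℕ} (A : Matrix (Fin m) (Fin n) ℝ) (v : Fin n → ℝ) :
    sqnorm (A.mulVec v) ≤ (∑ i, ∑ j, A i j ^ 2) * sqnorm v := by
  unfold sqnorm
  rw [Finset.sum_mul]
  refine Finset.sum_le_sum (fun i _ => ?_)
  exact Finset.sum_mul_sq_le_sq_mul_sq Finset.univ (A i) v

lemma rho_bddAbove {m n : ℕ} (A : Matrix (Fin m) (Fin n) ℝ) (s : ℕ) :
    BddAbove {r | ∃ x : Fin n → ℝ, x ≠ 0 ∧ l0 x ≤ s ∧ r = sqnorm (A.mulVec x) / sqnorm x} := by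
  refine ⟨∑ i, ∑ j, A i j ^ 2, ?_⟩
  rintro r ⟨x, hx, -, rfl⟩
  rw [div_le_iff₀ (sqnorm_pos hx)]
  exact sqnorm_mulVec_le A x

lemma rho_bddBelow {m n : ℕ} (A : Matrix (Fin m) (Fin n) ℝ) (s : ℕ) :
    BddBelow {r | ∃ x : Fin n → ℝ, x ≠ 0 ∧ l0 x ≤ s ∧ r = sqnorm (A.mulVec x) / sqnorm x} := by
  refine ⟨0, ?_⟩
  rintro r ⟨x, hx, -, rfl⟩
  exact div_nonneg (sqnorm_nonneg _) (sqnorm_nonneg _)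

lemma sqnorm_zero {n : ℕ} : sqnorm (0 : Fin n → ℝ) = 0 := by simp [sqnorm]

lemma le_rhoPlus {m n : ℕ} (A : Matrix (Fin m) (Fin n) ℝ) (s : ℕ) (v : Fin n → ℝ)
    (hv : l0 v ≤ s) : sqnorm (A.mulVec v) ≤ rhoPlus A s * sqnorm v := by
  by_cases h : v = 0
  · subst h; simp [sqnorm_zero]
  · rw [← div_le_iff₀ (sqnorm_pos h)]
    exact le_csSup (rho_bddAbove A s) ⟨v, h, hv, rfl⟩

lemma rhoMinus_le {m n : ℕ} (A : Matrix (Fin m) (Fin n) ℝ) (s : ℕ) (v : Fin n → ℝ)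
    (hv : l0 v ≤ s) : rhoMinus A s * sqnorm v ≤ sqnorm (A.mulVec v) := by
  by_cases h : v = 0
  · subst h; simp [sqnorm_zero]
  · rw [← le_div_iff₀ (sqnorm_pos h)]
    exact csInf_le (rho_bddBelow A s) ⟨v, h, hv, rfl⟩

lemma rhoMinus_pos_n {m n : ℕ} (A : Matrix (Fin m) (Fin n) ℝ) (s : ℕ)
    (h : 0 < rhoMinus A s) : 0 < n := by
  rcases Nat.eq_zero_or_pos n with h0 | h0
  · subst h0
    exfalso
    have : {r | ∃ x : Fin 0 → ℝ, x ≠ 0 ∧ l0 x ≤ s ∧ r = sqnorm (A.mulVec x) / sqnorm x} = ∅ := by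
      ext r
      simp only [Set.mem_ofPred_eq, Set.mem_empty_iff_false, iff_false]
      rintro ⟨x, hx, -⟩
      exact hx (Subsingleton.elim _ _)
    unfold rhoMinus at h
    rw [this, Real.sInf_empty] at h
    exact lt_irrefl _ h
  · exact h0

lemma exists_sparse {n : ℕ} (hn : 0 < n) : ∃ e : Fin n → ℝ, e ≠ 0 ∧ l0 e ≤ 1 := by
  refine ⟨Pi.single ⟨0, hn⟩ 1, ?_, ?_⟩
  · simp
  · unfold l0 supp
    rw [Finset.card_le_one]
    intro a ha c hc
    simp only [Finset.mem_filter, Finset.mem_univ, true_and, Pi.single_apply, ne_eq,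
      ite_eq_right_iff, one_ne_zero, imp_false, not_not] at ha hc
    rw [ha, hc]

lemma rhoMinus_anti {m n : ℕ} (A : Matrix (Fin m) (Fin n) ℝ) (hn : 0 < n) {s t : ℕ}
    (hs : 1 ≤ s) (hst : s ≤ t) : rhoMinus A t ≤ rhoMinus A s := by
  obtain ⟨e, he, he1⟩ := exists_sparse hn
  refine csInf_le_csInf (rho_bddBelow A t) ⟨_, e, he, he1.trans hs, rfl⟩ ?_
  rintro r ⟨x, hx, hxs, rfl⟩
  exact ⟨x, hx, hxs.trans hst, rfl⟩

lemma rhoMinus_le_rhoPlus {m n : ℕ} (A : Matrix (Fin m) (Fin n) ℝ) (hn : 0 < n) {s : ℕ}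
    (hs : 1 ≤ s) : rhoMinus A s ≤ rhoPlus A s := by
  obtain ⟨e, he, he1⟩ := exists_sparse hn
  have h1 := rhoMinus_le A s e (he1.trans hs)
  have h2 := le_rhoPlus A s e (he1.trans hs)
  exact le_of_mul_le_mul_right (h1.trans h2) (sqnorm_pos he)

lemma abs_le_linf {n : ℕ} (v : Fin n → ℝ) (i : Fin n) : |v i| ≤ linf v :=
  le_ciSup (f := fun i => |v i|) (Set.finite_range _).bddAbove i

lemma linf_nonneg {n : ℕ} (v : Fin n → ℝ) : 0 ≤ linf v :=
  Real.iSup_nonneg (fun i => abs_nonneg (v i))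

lemma l1_nonneg {n : ℕ} (v : Fin n → ℝ) : 0 ≤ l1 v :=
  Finset.sum_nonneg (fun i _ => abs_nonneg (v i))

lemma l1on_nonneg {n : ℕ} (S : Finset (Fin n)) (v : Fin n → ℝ) : 0 ≤ l1on S v :=
  Finset.sum_nonneg (fun i _ => abs_nonneg (v i))

lemma l1_split {n : ℕ} (S : Finset (Fin n)) (v : Fin n → ℝ) :
    l1 v = l1on S v + l1on Sᶜ v :=
  (Finset.sum_add_sum_compl S _).symm

lemma dot_le_of_bound {n : ℕ} (g v : Fin n → ℝ) (c : ℝ) (h : ∀ i, |g i| ≤ c) :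
    |dot g v| ≤ c * l1 v := by
  unfold dot l1
  refine (Finset.abs_sum_le_sum_abs _ _).trans ?_
  rw [Finset.mul_sum]
  refine Finset.sum_le_sum (fun i _ => ?_)
  rw [abs_mul]
  exact mul_le_mul_of_nonneg_right (h i) (abs_nonneg _)

lemma l1_diff {n : ℕ} (x xb : Fin n → ℝ) :
    l1on (supp xb)ᶜ (x - xb) - l1on (supp xb) (x - xb) ≤ l1 x - l1 xb := by
  rw [l1_split (supp xb) x, l1_split (supp xb) xb]
  have h1 : l1on (supp xb)ᶜ xb = 0 := by
    refine Finset.sum_eq_zero (fun i hi => ?_)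
    simp only [supp, Finset.mem_compl, Finset.mem_filter, Finset.mem_univ, true_and, not_not] at hi
    simp [hi]
  have h2 : l1on (supp xb)ᶜ (x - xb) = l1on (supp xb)ᶜ x := by
    refine Finset.sum_congr rfl (fun i hi => ?_)
    simp only [supp, Finset.mem_compl, Finset.mem_filter, Finset.mem_univ, true_and, not_not] at hi
    simp [hi]
  have h3 : l1on (supp xb) xb ≤ l1on (supp xb) x + l1on (supp xb) (x - xb) := by
    unfold l1on
    rw [← Finset.sum_add_distrib]
    refine Finset.sum_le_sum (fun i _ => ?_)
    have := abs_sub (x i) (x i - xb i)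
    simp only [sub_sub_cancel] at this
    simpa using this
  linarith

lemma l0_sub_le {n : ℕ} (x xb : Fin n → ℝ) :
    l0 (x - xb) ≤ (supp xb).card + l0on (supp xb)ᶜ x := by
  unfold l0 l0on
  refine le_trans (Finset.card_le_card ?_) (Finset.card_union_le _ _)
  intro i hi
  simp only [supp, Finset.mem_filter, Finset.mem_univ, true_and, Finset.mem_union,
    Finset.mem_compl, not_not, Pi.sub_apply] at hi ⊢
  by_cases h : xb i = 0
  · right; refine ⟨h, ?_⟩; intro h'; apply hi; rw [h, h', sub_zero]
  · left; exact h

lemma l0_sub_le2 {n : ℕ} (S : Finset (Fin n)) (x y : Fin n → ℝ) :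
    l0 (x - y) ≤ S.card + (l0on Sᶜ x + l0on Sᶜ y) := by
  unfold l0 l0on
  refine le_trans (Finset.card_le_card ?_) ((Finset.card_union_le _ _).trans
    (Nat.add_le_add_left (Finset.card_union_le _ _) _))
  intro i hi
  simp only [supp, Finset.mem_filter, Finset.mem_univ, true_and, Finset.mem_union,
    Finset.mem_compl, Pi.sub_apply] at hi ⊢
  by_cases h : i ∈ S
  · left; exact h
  · right
    by_contra hc
    push Not at hc
    apply hi
    rw [hc.1 h, hc.2 h, sub_zero]

lemma l1on_sq_le {n : ℕ} (S : Finset (Fin n)) (v : Fin n → ℝ) :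
    (l1on S v) ^ 2 ≤ (S.card : ℝ) * sqnorm v := by
  unfold l1on sqnorm
  refine (sq_sum_le_card_mul_sum_sq (s := S) (f := fun i => |v i|)).trans ?_
  refine mul_le_mul_of_nonneg_left ?_ (Nat.cast_nonneg _)
  simp only [sq_abs]
  exact Finset.sum_le_sum_of_subset_of_nonneg (Finset.subset_univ _) (fun i _ _ => sq_nonneg _)

/-- The infimum in the definition of the optimality residue is attained. -/
lemma omega_attained {m n : ℕ} (A : Matrix (Fin m) (Fin n) ℝ) (b : Fin m → ℝ) (lam : ℝ)
    (hlam : 0 < lam) (x : Fin n → ℝ) (c : ℝ) (h : omega A b lam x ≤ c) :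
    ∃ ξ, IsSubgrad x ξ ∧ ∀ i, |grad A b x i + lam * ξ i| ≤ c := by
  classical
  set g := grad A b x with hg
  let ξ : Fin n → ℝ := fun i =>
    if x i ≠ 0 then Real.sign (x i) else max (-1) (min 1 (-(g i) / lam))
  have hξ : IsSubgrad x ξ := by
    intro i
    refine ⟨fun hi => by simp [ξ, hi], fun hi => ?_⟩
    simp only [ξ, hi, ne_eq, not_true_eq_false, if_false]
    rw [abs_le]
    exact ⟨le_max_left _ _, max_le (by norm_num) (min_le_left _ _)⟩
  have hmin : ∀ η, IsSubgrad x η → ∀ i, |g i + lam * ξ i| ≤ |g i + lam * η i| := by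
    intro η hη i
    by_cases hi : x i = 0
    · have hb := abs_le.mp ((hη i).2 hi)
      have e : ξ i = max (-1) (min 1 (-(g i) / lam)) := by simp [ξ, hi]
      rcases le_total (-(g i) / lam) (-1) with h1 | h1
      · have : ξ i = -1 := by
          rw [e, min_eq_right (by linarith), max_eq_left h1]
        rw [this]
        rw [div_le_iff₀ hlam] at h1
        rw [abs_of_nonneg (by linarith)]
        refine le_trans ?_ (le_abs_self _)
        nlinarith
      · rcases le_total (-(g i) / lam) 1 with h2 | h2
        · have : ξ i = -(g i) / lam := by
            rw [e, min_eq_right h2, max_eq_right h1]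
          rw [this]
          have : g i + lam * (-(g i) / lam) = 0 := by field_simp; ring
          rw [this, abs_zero]; exact abs_nonneg _
        · have : ξ i = 1 := by
            rw [e, min_eq_left h2, max_eq_right (by norm_num)]
          rw [this]
          rw [le_div_iff₀ hlam] at h2
          rw [abs_of_nonpos (by linarith)]
          refine le_trans ?_ (neg_le_abs _)
          nlinarith
    · rw [(hη i).1 hi, (hξ i).1 hi]
  refine ⟨ξ, hξ, fun i => ?_⟩
  refine le_trans ?_ h
  refine le_csInf ⟨_, ξ, hξ, rfl⟩ ?_
  rintro r ⟨η, hη, rfl⟩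
  exact (hmin η hη i).trans (abs_le_linf (fun i => grad A b x i + lam * η i) i)

lemma subgrad_ineq {n : ℕ} (x ξ : Fin n → ℝ) (h : IsSubgrad x ξ) (u : Fin n → ℝ) :
    l1 x - l1 u ≤ dot ξ (x - u) := by
  unfold l1 dot
  rw [← Finset.sum_sub_distrib]
  refine Finset.sum_le_sum (fun i _ => ?_)
  simp only [Pi.sub_apply]
  have hab : |ξ i| ≤ 1 ∧ ξ i * x i = |x i| := by
    by_cases hi : x i = 0
    · refine ⟨(h i).2 hi, by simp [hi]⟩
    · rw [(h i).1 hi]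
      rcases lt_or_gt_of_ne hi with h0 | h0
      · rw [Real.sign_of_neg h0, abs_of_neg h0]; norm_num
      · rw [Real.sign_of_pos h0, abs_of_pos h0]; norm_num
  have : ξ i * u i ≤ |u i| := by
    calc ξ i * u i ≤ |ξ i * u i| := le_abs_self _
      _ = |ξ i| * |u i| := abs_mul _ _
      _ ≤ 1 * |u i| := mul_le_mul_of_nonneg_right hab.1 (abs_nonneg _)
      _ = |u i| := one_mul _
  nlinarith [hab.2]

lemma le_of_sq_le_sq_nonneg {a b : ℝ} (h : a ^ 2 ≤ b ^ 2) (hb : 0 ≤ b) : a ≤ b :=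
  (abs_le_of_sq_le_sq' h hb).2

lemma grad_eq {m n : ℕ} (A : Matrix (Fin m) (Fin n) ℝ) (b : Fin m → ℝ)
    (xbar : Fin n → ℝ) (z : Fin m → ℝ) (hb : b = A.mulVec xbar + z) (x : Fin n → ℝ) :
    grad A b x = Aᵀ.mulVec (A.mulVec (x - xbar)) - Aᵀ.mulVec z := by
  unfold grad
  rw [← Matrix.mulVec_sub, Matrix.mulVec_sub A, hb]
  congr 1; abel

lemma dot_sub_left {n : ℕ} (x y v : Fin n → ℝ) : dot (x - y) v = dot x v - dot y v := by
  simp only [dot, ← Finset.sum_sub_distrib, Pi.sub_apply, sub_mul]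

lemma dot_self {n : ℕ} (x : Fin n → ℝ) : dot x x = sqnorm x := by
  simp only [dot, sqnorm, sq]

lemma phi_diff {m n : ℕ} (A : Matrix (Fin m) (Fin n) ℝ) (b : Fin m → ℝ)
    (xbar : Fin n → ℝ) (z : Fin m → ℝ) (hb : b = A.mulVec xbar + z) (lam : ℝ) (x : Fin n → ℝ) :
    phi A b lam x - phi A b lam xbar = sqnorm (A.mulVec (x - xbar)) / 2
      - dot (Aᵀ.mulVec z) (x - xbar) + lam * (l1 x - l1 xbar) := by
  unfold phi
  rw [fls_expand A b x xbar, grad_eq A b xbar z hb, dot_sub_left, sub_self, Matrix.mulVec_zero,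
    Matrix.mulVec_zero]
  have : dot (0 : Fin n → ℝ) (x - xbar) = 0 := by simp [dot]
  rw [this]; ring

/-- Restricted strong convexity bound for the on-support part. -/
lemma support_bound {m n : ℕ} (A : Matrix (Fin m) (Fin n) ℝ) (xbar x : Fin n → ℝ) (st : ℕ)
    (hsp : l0on (supp xbar)ᶜ x ≤ st) :
    rhoMinus A ((supp xbar).card + st) * (l1on (supp xbar) (x - xbar)) ^ 2
      ≤ ((supp xbar).card : ℝ) * sqnorm (A.mulVec (x - xbar)) ∨
      rhoMinus A ((supp xbar).card + st) < 0 := by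
  rcases lt_or_ge (rhoMinus A ((supp xbar).card + st)) 0 with h | h
  · exact Or.inr h
  left
  have h1 := l1on_sq_le (supp xbar) (x - xbar)
  have h2 := rhoMinus_le A _ (x - xbar) ((l0_sub_le x xbar).trans (Nat.add_le_add_left hsp _))
  calc _ ≤ rhoMinus A ((supp xbar).card + st) * (((supp xbar).card : ℝ) * sqnorm (x - xbar)) :=
        mul_le_mul_of_nonneg_left h1 h
    _ = ((supp xbar).card : ℝ) * (rhoMinus A ((supp xbar).card + st) * sqnorm (x - xbar)) := by ring
    _ ≤ _ := mul_le_mul_of_nonneg_left h2 (Nat.cast_nonneg _)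

set_option maxHeartbeats 1600000 in
lemma init_bound {m n : ℕ} (A : Matrix (Fin m) (Fin n) ℝ) (b : Fin m → ℝ)
    (xbar : Fin n → ℝ) (z : Fin m → ℝ) (hb : b = A.mulVec xbar + z)
    (dp gam lam : ℝ) (hdp0 : 0 < dp) (hdp1 : dp < 1)
    (hgam : gam > (1 + dp) / (1 - dp))
    (hlam : 0 < lam) (hnoise : noiseCond A z dp gam lam) (st : ℕ)
    (hrho : 0 < rhoMinus A ((supp xbar).card + st))
    (x : Fin n → ℝ) (hsp : l0on (supp xbar)ᶜ x ≤ st) (hk : omega A b lam x ≤ dp * lam) :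
    phi A b lam x - phi A b lam xbar ≤
      2 * lam ^ 2 * ((1 + gam) * ((supp xbar).card : ℝ) / rhoMinus A ((supp xbar).card + st)) := by
  obtain ⟨ξ, hξ, hξb⟩ := omega_attained A b lam hlam x _ hk
  have hsup := (support_bound A xbar x st hsp).resolve_right (not_lt.mpr hrho.le)
  set ρ := rhoMinus A ((supp xbar).card + st) with hρ
  set s : ℝ := ((supp xbar).card : ℝ) with hs
  have hs0 : 0 ≤ s := Nat.cast_nonneg _
  set ν := linf (Aᵀ.mulVec z) with hν
  have hν0 : 0 ≤ ν := linf_nonneg _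
  set a := l1on (supp xbar) (x - xbar) with ha
  set D := l1on (supp xbar)ᶜ (x - xbar) with hD
  have ha0 : 0 ≤ a := l1on_nonneg _ _
  have hD0 : 0 ≤ D := l1on_nonneg _ _
  set Y := sqnorm (A.mulVec (x - xbar)) with hY
  have hY0 : 0 ≤ Y := sqnorm_nonneg _
  have hl : l1 (x - xbar) = a + D := l1_split _ _
  have hdif : D - a ≤ l1 x - l1 xbar := l1_diff x xbar
  have hsg := subgrad_ineq x ξ hξ xbar
  have hz := dot_le_of_bound (Aᵀ.mulVec z) (x - xbar) ν (fun i => abs_le_linf _ i)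
  rw [hl] at hz
  have hz2 := abs_le.mp hz
  have h1 := dot_le_of_bound (fun i => grad A b x i + lam * ξ i) (x - xbar) (dp * lam) hξb
  rw [hl] at h1
  have h2 : dot (fun i => grad A b x i + lam * ξ i) (x - xbar)
      = Y - dot (Aᵀ.mulVec z) (x - xbar) + lam * dot ξ (x - xbar) := by
    have e : dot (fun i => grad A b x i + lam * ξ i) (x - xbar)
        = dot (grad A b x) (x - xbar) + lam * dot ξ (x - xbar) := by
      simp only [dot, Finset.mul_sum, ← Finset.sum_add_distrib]
      exact Finset.sum_congr rfl (fun i _ => by ring)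
    rw [e, grad_eq A b xbar z hb, dot_sub_left, dot_transpose, dot_self]
  rw [h2] at h1
  have h3 := (abs_le.mp h1).2
  have hpd := phi_diff A b xbar z hb lam x
  -- gamma facts
  have hd1 : 0 < 1 - dp := by linarith
  have hg1 : 1 + dp < gam * (1 - dp) := by
    have := hgam; rw [gt_iff_lt, div_lt_iff₀ hd1] at this; exact this
  have hg : 0 < gam := by
    by_contra hc; push Not at hc; nlinarith
  have hden : 0 < (1 - dp) * gam - (1 + dp) := by linarith
  have hn2 : (gam + 1) * ν ≤ lam * ((1 - dp) * gam - (1 + dp)) := by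
    have h := hnoise
    unfold noiseCond at h
    have h' : (gam + 1) / ((1 - dp) * gam - (1 + dp)) * ν ≤ lam :=
      le_trans (mul_le_mul_of_nonneg_right (le_max_right _ _) hν0) h
    rw [div_mul_eq_mul_div, div_le_iff₀ hden] at h'
    exact h'
  have hp : (1 + dp) * lam + ν ≤ gam * ((1 - dp) * lam - ν) := by nlinarith
  have hpp : 0 < (1 - dp) * lam - ν := by
    by_contra hc; push Not at hc
    nlinarith [mul_pos hdp0 hlam]
  have hmain : Y + ((1 - dp) * lam - ν) * D ≤ ((1 + dp) * lam + ν) * a := by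
    have := mul_le_mul_of_nonneg_left (hdif.trans hsg) hlam.le
    nlinarith [hz2.2, h3, this]
  have hcone : D ≤ gam * a := by
    have : ((1 - dp) * lam - ν) * D ≤ ((1 - dp) * lam - ν) * (gam * a) := by
      have t := mul_le_mul_of_nonneg_right hp ha0
      rw [mul_assoc] at t
      calc ((1 - dp) * lam - ν) * D ≤ ((1 + dp) * lam + ν) * a := by linarith
        _ ≤ _ := t
        _ = _ := by ring
    exact le_of_mul_le_mul_left this hpp
  have hYa : Y ≤ 2 * lam * a := by
    have t1 := mul_nonneg hpp.le hD0
    have t2 := mul_nonneg hpp.le ha0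
    have t3 : 2 * lam * a = ((1 + dp) * lam + ν) * a + ((1 - dp) * lam - ν) * a := by ring
    linarith
  have haa : ρ * a ≤ 2 * lam * s := by
    rcases ha0.eq_or_lt with h0 | h0
    · rw [← h0, mul_zero]; positivity
    · have : a * (ρ * a) ≤ a * (2 * lam * s) := by
        nlinarith [mul_le_mul_of_nonneg_left hYa hs0]
      exact le_of_mul_le_mul_left this h0
  have hfin : phi A b lam x - phi A b lam xbar ≤ lam * ((1 + gam) * a) := by
    rw [hpd]
    have t1 := mul_le_mul_of_nonneg_left hsg hlam.le
    have t2 : dp * lam * (a + D) ≤ lam * ((1 + gam) * a) := by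
      have : a + D ≤ (1 + gam) * a := by linarith
      have t3 : dp * lam ≤ lam := by nlinarith
      calc dp * lam * (a + D) ≤ lam * (a + D) :=
            mul_le_mul_of_nonneg_right t3 (by linarith)
        _ ≤ _ := mul_le_mul_of_nonneg_left this hlam.le
    linarith
  refine hfin.trans ?_
  rw [mul_div_assoc', le_div_iff₀ hrho]
  have : 0 ≤ lam * (1 + gam) := by positivity
  nlinarith [mul_le_mul_of_nonneg_left haa this]

lemma level_bound {m n : ℕ} (A : Matrix (Fin m) (Fin n) ℝ) (b : Fin m → ℝ)
    (xbar : Fin n → ℝ) (z : Fin m → ℝ) (hb : b = A.mulVec xbar + z)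
    (gam lam : ℝ) (hg : 1 < gam) (hlam : 0 < lam)
    (hz4 : 4 * linf (Aᵀ.mulVec z) ≤ lam) (st : ℕ)
    (hrho : 0 < rhoMinus A ((supp xbar).card + st))
    (x : Fin n → ℝ) (hsp : l0on (supp xbar)ᶜ x ≤ st)
    (c : ℝ) (hc : c = (1 + gam) * ((supp xbar).card : ℝ) / rhoMinus A ((supp xbar).card + st))
    (hphi : phi A b lam x - phi A b lam xbar ≤ 2 * lam ^ 2 * c) :
    sqnorm (A.mulVec (x - xbar)) / 4 + 3 / 4 * lam * l1on (supp xbar)ᶜ (x - xbar)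
      ≤ 3 * lam ^ 2 * c := by
  have hsup := (support_bound A xbar x st hsp).resolve_right (not_lt.mpr hrho.le)
  set ρ := rhoMinus A ((supp xbar).card + st) with hρ
  set s : ℝ := ((supp xbar).card : ℝ) with hs
  have hs0 : 0 ≤ s := Nat.cast_nonneg _
  set ν := linf (Aᵀ.mulVec z) with hν
  have hν0 : 0 ≤ ν := linf_nonneg _
  set a := l1on (supp xbar) (x - xbar) with ha
  set D := l1on (supp xbar)ᶜ (x - xbar) with hD
  have ha0 : 0 ≤ a := l1on_nonneg _ _
  have hD0 : 0 ≤ D := l1on_nonneg _ _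
  set Y := sqnorm (A.mulVec (x - xbar)) with hY
  have hY0 : 0 ≤ Y := sqnorm_nonneg _
  have hl : l1 (x - xbar) = a + D := l1_split _ _
  have hdif : D - a ≤ l1 x - l1 xbar := l1_diff x xbar
  have hz := dot_le_of_bound (Aᵀ.mulVec z) (x - xbar) ν (fun i => abs_le_linf _ i)
  rw [hl] at hz
  have hz2 := abs_le.mp hz
  have hpd := phi_diff A b xbar z hb lam x
  rw [hpd] at hphi
  obtain ⟨σ, hσ⟩ : ∃ σ, σ = s / ρ := ⟨_, rfl⟩
  have hσ0 : 0 ≤ σ := by rw [hσ]; positivity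
  have hcσ : c = (1 + gam) * σ := by rw [hc, hσ]; ring
  have haσ : a ^ 2 ≤ σ * Y := by
    rw [hσ, div_mul_eq_mul_div, le_div_iff₀ hrho]; linarith
  have hbase : Y / 2 + 3 / 4 * lam * D ≤ 2 * lam ^ 2 * c + 5 / 4 * lam * a := by
    have t1 := mul_le_mul_of_nonneg_left hdif hlam.le
    have t2 : ν * (a + D) ≤ lam / 4 * (a + D) :=
      mul_le_mul_of_nonneg_right (by linarith) (by linarith)
    linarith [hz2.2]
  have hamgm : 5 / 4 * lam * a ≤ Y / 4 + 25 / 16 * lam ^ 2 * σ := by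
    have hl2 : 0 ≤ lam ^ 2 * σ := by positivity
    have h2 := mul_le_mul_of_nonneg_left haσ (sq_nonneg lam)
    refine le_of_sq_le_sq_nonneg (b := Y / 4 + 25 / 16 * lam ^ 2 * σ) ?_ (by linarith)
    nlinarith [sq_nonneg (Y / 4 - 25 / 16 * lam ^ 2 * σ)]
  have hσc : 2 * σ ≤ c := by rw [hcσ]; nlinarith
  have := mul_le_mul_of_nonneg_left hσc (sq_nonneg lam)
  have hc0 : 0 ≤ lam ^ 2 * c := by
    rw [hcσ]; positivity
  linarith

lemma psi_coord {m n : ℕ} (A : Matrix (Fin m) (Fin n) ℝ) (b : Fin m → ℝ) (lam L : ℝ)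
    (hL : 0 < L) (y xp : Fin n → ℝ)
    (h : ∀ u, psi A b lam L y xp ≤ psi A b lam L y u) (i : Fin n) (hi : xp i ≠ 0) :
    lam ≤ |L * y i - grad A b y i| := by
  classical
  have h1 := h (Function.update xp i 0)
  set g := grad A b y with hg
  have e : ∀ u, psi A b lam L y u = fls A b y +
      ∑ j, (g j * (u j - y j) + L / 2 * (u j - y j) ^ 2 + lam * |u j|) := by
    intro u
    simp only [psi, dot, sqnorm, l1, Finset.sum_add_distrib, Finset.mul_sum, Pi.sub_apply, hg]
    ring
  rw [e, e, ← Finset.add_sum_erase _ _ (Finset.mem_univ i),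
    ← Finset.add_sum_erase (a := i) Finset.univ (fun j => g j * ((Function.update xp i 0) j - y j) +
      L / 2 * ((Function.update xp i 0) j - y j) ^ 2 + lam * |(Function.update xp i 0) j|)
      (Finset.mem_univ i)] at h1
  have e2 : ∑ j ∈ Finset.univ.erase i, (g j * ((Function.update xp i 0) j - y j) +
      L / 2 * ((Function.update xp i 0) j - y j) ^ 2 + lam * |(Function.update xp i 0) j|)
      = ∑ j ∈ Finset.univ.erase i, (g j * (xp j - y j) + L / 2 * (xp j - y j) ^ 2
        + lam * |xp j|) := by
    refine Finset.sum_congr rfl (fun j hj => ?_)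
    rw [Function.update_of_ne (Finset.ne_of_mem_erase hj)]
  rw [e2] at h1
  simp only [Function.update_self, abs_zero] at h1
  have h2 : lam * |xp i| ≤ (L * y i - g i) * xp i := by nlinarith [mul_nonneg hL.le (sq_nonneg (xp i))]
  have h3 : (L * y i - g i) * xp i ≤ |L * y i - g i| * |xp i| := by
    rw [← abs_mul]; exact le_abs_self _
  exact le_of_mul_le_mul_right (h2.trans h3) (abs_pos.mpr hi)

lemma sparse_step {m n : ℕ} (A : Matrix (Fin m) (Fin n) ℝ) (b : Fin m → ℝ)
    (xbar : Fin n → ℝ) (z : Fin m → ℝ) (hb : b = A.mulVec xbar + z)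
    (lam : ℝ) (hlam : 0 < lam)
    (hz4 : 4 * linf (Aᵀ.mulVec z) ≤ lam) (st : ℕ)
    (hrp : 0 < rhoPlus A st)
    (x xp : Fin n → ℝ) (L c : ℝ) (hL : 0 < L)
    (hst : 16 * (L + 2 * rhoPlus A st) * c < st)
    (hlev : sqnorm (A.mulVec (x - xbar)) / 4 + 3 / 4 * lam * l1on (supp xbar)ᶜ (x - xbar)
      ≤ 3 * lam ^ 2 * c)
    (hmin : ∀ u, psi A b lam L x xp ≤ psi A b lam L x u) :
    l0on (supp xbar)ᶜ xp ≤ st := by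
  classical
  by_contra hcon
  push Not at hcon
  unfold l0on at hcon
  obtain ⟨I, hIs, hIc⟩ := Finset.exists_subset_card_eq hcon.le
  set g := grad A b x with hg
  set ν := linf (Aᵀ.mulVec z) with hν
  set D := l1on (supp xbar)ᶜ (x - xbar) with hD
  have hD0 : 0 ≤ D := l1on_nonneg _ _
  set Y := sqnorm (A.mulVec (x - xbar)) with hY
  have hY0 : 0 ≤ Y := sqnorm_nonneg _
  set r := rhoPlus A st with hr
  have hgi : ∀ i, g i = (Aᵀ.mulVec (A.mulVec (x - xbar))) i - (Aᵀ.mulVec z) i := by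
    intro i; rw [hg, grad_eq A b xbar z hb]; rfl
  set q := Aᵀ.mulVec (A.mulVec (x - xbar)) with hq
  let w : Fin n → ℝ := fun i => if i ∈ I then (if 0 ≤ q i then 1 else -1) else 0
  have hwq : dot q w = ∑ i ∈ I, |q i| := by
    unfold dot
    rw [← Finset.sum_subset (Finset.subset_univ I)]
    · refine Finset.sum_congr rfl (fun i hi => ?_)
      simp only [w, hi, if_true]
      split_ifs with h
      · rw [abs_of_nonneg h, mul_one]
      · rw [abs_of_neg (not_le.mp h)]; ring
    · intro i _ hi; simp [w, hi]
  have hwn : sqnorm w = st := by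
    unfold sqnorm
    rw [← Finset.sum_subset (Finset.subset_univ I)]
    · rw [← hIc, Finset.card_eq_sum_ones]
      push_cast
      refine Finset.sum_congr rfl (fun i hi => ?_)
      simp only [w, hi, if_true]
      split_ifs <;> norm_num
    · intro i _ hi; simp [w, hi]
  have hw0 : l0 w ≤ st := by
    rw [← hIc]
    refine Finset.card_le_card (fun i hi => ?_)
    simp only [supp, Finset.mem_filter, Finset.mem_univ, true_and, w] at hi
    by_contra h; simp [h] at hi
  have hAw := le_rhoPlus A st w hw0
  rw [hwn, ← hr] at hAw
  rw [hq, dot_transpose] at hwq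
  have hcs := dot_sq_le (A.mulVec (x - xbar)) (A.mulVec w)
  rw [← hY] at hcs
  rw [← hq] at hwq
  set Q := ∑ i ∈ I, |q i| with hQ
  rw [hwq] at hcs
  have hN0 : (0:ℝ) ≤ st := Nat.cast_nonneg _
  have hQ2 : Q ^ 2 ≤ Y * (r * st) := hcs.trans (mul_le_mul_of_nonneg_left hAw hY0)
  have hmemc : ∀ i ∈ I, i ∈ (supp xbar)ᶜ ∧ xp i ≠ 0 := fun i hi => by
    simpa using Finset.mem_filter.mp (hIs hi)
  have hsum : (st : ℝ) * lam ≤ L * D + Q + ν * st := by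
    have t1 : ∀ i ∈ I, lam ≤ L * |(x - xbar) i| + |q i| + ν := by
      intro i hi
      have h1 := psi_coord A b lam L hL x xp hmin i (hmemc i hi).2
      have hxb : xbar i = 0 := by
        have := (hmemc i hi).1
        simpa [supp] using this
      rw [← hg, hgi i] at h1
      have h2 := abs_le_linf (Aᵀ.mulVec z) i
      have e : L * x i - (q i - (Aᵀ.mulVec z) i) = L * x i + (- q i) + (Aᵀ.mulVec z) i := by ring
      rw [e] at h1
      have h3 := abs_add_three (L * x i) (- q i) ((Aᵀ.mulVec z) i)
      rw [abs_mul, abs_of_pos hL, abs_neg] at h3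
      simp only [Pi.sub_apply, hxb, sub_zero]
      linarith
    have t2 := Finset.sum_le_sum t1
    rw [Finset.sum_add_distrib, Finset.sum_add_distrib, ← Finset.mul_sum] at t2
    simp only [Finset.sum_const, nsmul_eq_mul, hIc] at t2
    have t3 : ∑ i ∈ I, |(x - xbar) i| ≤ D :=
      Finset.sum_le_sum_of_subset_of_nonneg (fun i hi => (hmemc i hi).1) (fun _ _ _ => abs_nonneg _)
    have t4 := mul_le_mul_of_nonneg_left t3 hL.le
    linarith
  have hνs : ν * st ≤ lam / 4 * st := mul_le_mul_of_nonneg_right (by linarith) hN0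
  -- AM-GM: lam * Q ≤ 3/8 lam^2 st + 2/3 r Y
  have hQam : lam * Q ≤ 3 / 8 * lam ^ 2 * st + 2 / 3 * (r * Y) := by
    have hrY := mul_nonneg hrp.le hY0
    have hls : 0 ≤ lam ^ 2 * (st : ℝ) := by positivity
    have h2 := mul_le_mul_of_nonneg_left hQ2 (sq_nonneg lam)
    refine le_of_sq_le_sq_nonneg (b := 3 / 8 * lam ^ 2 * st + 2 / 3 * (r * Y)) ?_ (by linarith)
    nlinarith [sq_nonneg (3 / 8 * lam ^ 2 * st - 2 / 3 * (r * Y))]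
  have hDb : D ≤ 4 * lam * c := by
    have : lam * D ≤ lam * (4 * lam * c) := by nlinarith
    exact le_of_mul_le_mul_left this hlam
  have hYb : Y ≤ 12 * lam ^ 2 * c := by
    nlinarith [mul_nonneg hlam.le hD0]
  have f1 := mul_le_mul_of_nonneg_left hDb (mul_pos hlam hL).le
  have f2 := mul_le_mul_of_nonneg_left hYb hrp.le
  have f3 := mul_le_mul_of_nonneg_left hsum hlam.le
  have f4 := mul_le_mul_of_nonneg_left hνs hlam.le
  have hc0 : 0 ≤ c := by
    by_contra hc; push Not at hc
    nlinarith [mul_pos hlam hlam]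
  have fin1 : lam ^ 2 * (3 / 8 * st) ≤ lam ^ 2 * (4 * L * c + 8 * r * c) := by nlinarith
  have fin2 := le_of_mul_le_mul_left fin1 (by positivity)
  nlinarith [mul_nonneg hL.le hc0, mul_nonneg hrp.le hc0]

lemma l1_convex {n : ℕ} (y v : Fin n → ℝ) (α : ℝ) (h0 : 0 ≤ α) (h1 : α ≤ 1) :
    l1 (y + α • (v - y)) ≤ (1 - α) * l1 y + α * l1 v := by
  unfold l1
  rw [Finset.mul_sum, Finset.mul_sum, ← Finset.sum_add_distrib]
  refine Finset.sum_le_sum (fun i _ => ?_)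
  have e : (y + α • (v - y)) i = (1 - α) * y i + α * v i := by
    simp only [Pi.add_apply, Pi.smul_apply, Pi.sub_apply, smul_eq_mul]; ring
  rw [e]
  refine (abs_add_le _ _).trans ?_
  rw [abs_mul, abs_mul, abs_of_nonneg h0, abs_of_nonneg (by linarith : 0 ≤ 1 - α)]

lemma descent_step {m n : ℕ} (A : Matrix (Fin m) (Fin n) ℝ) (b : Fin m → ℝ) (lam L : ℝ)
    (hlam : 0 < lam) (y xp v : Fin n → ℝ)
    (hmin : ∀ u, psi A b lam L y xp ≤ psi A b lam L y u)
    (hd : phi A b lam xp ≤ psi A b lam L y xp) (α : ℝ) (h0 : 0 ≤ α) (h1 : α ≤ 1) :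
    phi A b lam xp ≤ (1 - α) * phi A b lam y + α * phi A b lam v
      + L / 2 * (α ^ 2 * sqnorm (v - y)) := by
  have h := hd.trans (hmin (y + α • (v - y)))
  unfold psi at h
  rw [add_sub_cancel_left, dot_smul_right, sqnorm_smul] at h
  have hl := mul_le_mul_of_nonneg_left (l1_convex y v α h0 h1) hlam.le
  have hf := fls_expand A b v y
  have hq := mul_nonneg h0 (sqnorm_nonneg (A.mulVec (v - y)))
  unfold phi at h ⊢
  rw [hf]
  nlinarith

lemma phi_cont {m n : ℕ} (A : Matrix (Fin m) (Fin n) ℝ) (b : Fin m → ℝ) (lam : ℝ) :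
    Continuous (phi A b lam) := by
  unfold phi fls sqnorm l1 Matrix.mulVec dotProduct
  simp only [Pi.sub_apply]
  fun_prop

lemma level_compact {m n : ℕ} (A : Matrix (Fin m) (Fin n) ℝ) (b : Fin m → ℝ) (lam : ℝ)
    (hlam : 0 < lam) (c : ℝ) : IsCompact {u | phi A b lam u ≤ c} := by
  refine (isCompact_closedBall (0 : Fin n → ℝ) (c / lam)).of_isClosed_subset
    (isClosed_le (phi_cont A b lam) continuous_const) ?_
  intro u hu
  have hu' : phi A b lam u ≤ c := hu
  have hl : l1 u ≤ c / lam := by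
    rw [le_div_iff₀ hlam]
    unfold phi fls at hu'
    linarith [sqnorm_nonneg (A.mulVec u - b)]
  rw [mem_closedBall_zero_iff, pi_norm_le_iff_of_nonneg ((l1_nonneg u).trans hl)]
  intro i
  refine le_trans ?_ hl
  rw [Real.norm_eq_abs]
  exact Finset.single_le_sum (f := fun i => |u i|) (fun i _ => abs_nonneg _) (Finset.mem_univ i)

lemma sparse_closed {n : ℕ} (S : Finset (Fin n)) (st : ℕ) :
    IsClosed {u : Fin n → ℝ | l0on S u ≤ st} := by
  classical
  have e : {u : Fin n → ℝ | l0on S u ≤ st} =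
      ⋃ T ∈ {T : Finset (Fin n) | T.card ≤ st}, {u : Fin n → ℝ | ∀ i ∈ S \ T, u i = 0} := by
    ext u
    simp only [Set.mem_ofPred_eq, Set.mem_iUnion, exists_prop]
    constructor
    · intro h
      refine ⟨_, h, fun i hi => ?_⟩
      rw [Finset.mem_sdiff, Finset.mem_filter] at hi
      by_contra hc
      exact hi.2 ⟨hi.1, hc⟩
    · rintro ⟨T, hT, h⟩
      refine le_trans (Finset.card_le_card fun i hi => ?_) hT
      rw [Finset.mem_filter] at hi
      by_contra hc
      exact hi.2 (h i (Finset.mem_sdiff.mpr ⟨hi.1, hc⟩))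
  rw [e]
  refine Set.Finite.isClosed_biUnion (Set.toFinite _) (fun T _ => ?_)
  have : {u : Fin n → ℝ | ∀ i ∈ S \ T, u i = 0} = ⋂ i ∈ S \ T, {u : Fin n → ℝ | u i = 0} := by
    ext u; simp
  rw [this]
  exact isClosed_biInter (fun i _ => isClosed_eq (continuous_apply i) continuous_const)

lemma grad_min_strong {m n : ℕ} (A : Matrix (Fin m) (Fin n) ℝ) (b : Fin m → ℝ) (lam : ℝ)
    (hlam : 0 < lam) (xs u : Fin n → ℝ) (hmin : ∀ u, phi A b lam xs ≤ phi A b lam u) :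
    sqnorm (A.mulVec (u - xs)) / 2 ≤ phi A b lam u - phi A b lam xs := by
  have key : ∀ α : ℝ, 0 < α → α ≤ 1 →
      sqnorm (A.mulVec (u - xs)) / 2 * (1 - α) ≤ phi A b lam u - phi A b lam xs := by
    intro α h0 h1
    have h := hmin (xs + α • (u - xs))
    have hl := mul_le_mul_of_nonneg_left (l1_convex xs u α h0.le h1) hlam.le
    have e1 := fls_expand A b (xs + α • (u - xs)) xs
    rw [add_sub_cancel_left, dot_smul_right, Matrix.mulVec_smul, sqnorm_smul] at e1
    have e2 := fls_expand A b u xs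
    unfold phi at h ⊢
    refine le_of_mul_le_mul_left (a := α) ?_ h0
    nlinarith
  by_contra hc
  push Not at hc
  have hq := sqnorm_nonneg (A.mulVec (u - xs))
  set Q := sqnorm (A.mulVec (u - xs)) / 2 with hQ
  set d := phi A b lam u - phi A b lam xs with hd
  have hd0 : 0 ≤ d := sub_nonneg.mpr (hmin u)
  have hQ0 : 0 < Q := lt_of_le_of_lt hd0 hc
  have := key ((Q - d) / (2 * Q)) (div_pos (by linarith) (by linarith))
    (by rw [div_le_one (by linarith)]; linarith)
  have e : Q * (1 - (Q - d) / (2 * Q)) = (Q + d) / 2 := by field_simp; ring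
  rw [e] at this
  linarith

theorem stmt8 {m n : ℕ} (A : Matrix (Fin m) (Fin n) ℝ) (b : Fin m → ℝ)
    (xbar : Fin n → ℝ) (z : Fin m → ℝ) (hb : b = A.mulVec xbar + z)
    (dp gam lam : ℝ) (hdp0 : 0 < dp) (hdp1 : dp < 1)
    (hgam : gam > (1 + dp) / (1 - dp))
    (hlam : 0 < lam) (hnoise : noiseCond A z dp gam lam)
    (Gu : ℝ) (hGu : 1 < Gu) (st : ℕ) (hst : 1 ≤ st)
    (hrho : 0 < rhoMinus A ((supp xbar).card + 2 * st))
    (hstbig : (st : ℝ) > 16 * (Gu * rhoPlus A ((supp xbar).card + 2 * st)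
        + 2 * rhoPlus A st) * (1 + gam) * ((supp xbar).card : ℝ) /
        rhoMinus A ((supp xbar).card + st))
    (x : ℕ → Fin n → ℝ) (M : ℕ → ℝ)
    (hM0 : ∀ k, 0 < M k)
    (hM1 : ∀ k, M k ≤ Gu * rhoPlus A ((supp xbar).card + 2 * st))
    (hstep : ∀ k, ∀ u, psi A b lam (M k) (x k) (x (k + 1)) ≤ psi A b lam (M k) (x k) u)
    (hdescent : ∀ k, phi A b lam (x (k + 1)) ≤ psi A b lam (M k) (x k) (x (k + 1)))
    (hx0sp : l0on (supp xbar)ᶜ (x 0) ≤ st)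
    (hx0kkt : omega A b lam (x 0) ≤ dp * lam) :
    ∃ xstar : Fin n → ℝ, (∀ u, phi A b lam xstar ≤ phi A b lam u) ∧
      l0on (supp xbar)ᶜ xstar ≤ st ∧
      ∀ k : ℕ, l0on (supp xbar)ᶜ (x k) ≤ st ∧
        phi A b lam (x k) - phi A b lam xstar ≤
          (1 - 1 / (4 * Gu * (rhoPlus A ((supp xbar).card + 2 * st) /
              rhoMinus A ((supp xbar).card + 2 * st)))) ^ k *
            (phi A b lam (x 0) - phi A b lam xstar) := by
  have hn : 0 < n := rhoMinus_pos_n A _ hrho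
  have hrho1 : 0 < rhoMinus A ((supp xbar).card + st) :=
    lt_of_lt_of_le hrho (rhoMinus_anti A hn (by omega) (by omega))
  have hrps : 0 < rhoPlus A st :=
    lt_of_lt_of_le (lt_of_lt_of_le hrho (rhoMinus_anti A hn hst (by omega)))
      (rhoMinus_le_rhoPlus A hn hst)
  have hrle : rhoMinus A ((supp xbar).card + 2 * st) ≤ rhoPlus A ((supp xbar).card + 2 * st) :=
    rhoMinus_le_rhoPlus A hn (by omega)
  have hd1 : 0 < 1 - dp := by linarith
  have hg1 : 1 < gam := by
    refine lt_of_le_of_lt ?_ hgam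
    rw [le_div_iff₀ hd1]; linarith
  have hz4 : 4 * linf (Aᵀ.mulVec z) ≤ lam :=
    le_trans (mul_le_mul_of_nonneg_right (le_max_left _ _) (linf_nonneg _)) hnoise
  obtain ⟨c, hc⟩ : ∃ c, c = (1 + gam) * ((supp xbar).card : ℝ)
    / rhoMinus A ((supp xbar).card + st) := ⟨_, rfl⟩
  have hc0 : 0 ≤ c := by rw [hc]; positivity
  have hinit : phi A b lam (x 0) - phi A b lam xbar ≤ 2 * lam ^ 2 * c := by
    rw [hc]
    exact init_bound A b xbar z hb dp gam lam hdp0 hdp1 hgam hlam hnoise st hrho1 (x 0) hx0sp hx0kkt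
  set B := Gu * rhoPlus A ((supp xbar).card + 2 * st) with hB
  have hstc : 16 * (B + 2 * rhoPlus A st) * c < st := by
    have e : 16 * (B + 2 * rhoPlus A st) * c = 16 * (B + 2 * rhoPlus A st) * (1 + gam)
        * ((supp xbar).card : ℝ) / rhoMinus A ((supp xbar).card + st) := by rw [hc]; ring
    rw [e]; exact hstbig
  have hmono : ∀ k, phi A b lam (x (k + 1)) ≤ phi A b lam (x k) := by
    intro k
    have := descent_step A b lam (M k) hlam (x k) (x (k + 1)) (x k) (hstep k) (hdescent k) 0
      le_rfl zero_le_one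
    simpa using this
  have hle0 : ∀ k, phi A b lam (x k) ≤ phi A b lam (x 0) := by
    intro k
    induction k with
    | zero => exact le_rfl
    | succ k ih => exact (hmono k).trans ih
  have hsparse : ∀ k, l0on (supp xbar)ᶜ (x k) ≤ st := by
    intro k
    induction k with
    | zero => exact hx0sp
    | succ k ih =>
      have hlev := level_bound A b xbar z hb gam lam hg1 hlam hz4 st hrho1 (x k) ih c hc
        (by linarith [hle0 k])
      refine sparse_step A b xbar z hb lam hlam hz4 st hrps (x k) (x (k + 1)) (M k) c (hM0 k) ?_
        hlev (hstep k)
      refine lt_of_le_of_lt ?_ hstc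
      exact mul_le_mul_of_nonneg_right (by linarith [hM1 k]) hc0
  have hB0 : 0 < B := mul_pos (by linarith) (lt_of_lt_of_le hrho hrle)
  have hK : IsCompact ({u | phi A b lam u ≤ phi A b lam (x 0)} ∩
      {u | l0on (supp xbar)ᶜ u ≤ st}) :=
    (level_compact A b lam hlam _).inter_right (sparse_closed _ _)
  obtain ⟨xs, hxsK, hxsmin⟩ := hK.exists_isMinOn ⟨x 0, le_refl (phi A b lam (x 0)), hx0sp⟩ (phi_cont A b lam).continuousOn
  have hxsle : ∀ k, phi A b lam xs ≤ phi A b lam (x k) := fun k => hxsmin ⟨hle0 k, hsparse k⟩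
  have hopt : ∀ u, phi A b lam xs ≤ phi A b lam u := by
    intro v
    by_contra hcon
    push Not at hcon
    obtain ⟨ε, hε⟩ : ∃ ε, ε = phi A b lam xs - phi A b lam v := ⟨_, rfl⟩
    have hε0 : 0 < ε := by rw [hε]; linarith
    have hcont : Continuous (fun u : Fin n → ℝ => sqnorm (v - u)) := by
      unfold sqnorm; simp only [Pi.sub_apply]; fun_prop
    obtain ⟨R, hR⟩ := (level_compact A b lam hlam (phi A b lam (x 0))).bddAbove_image
      hcont.continuousOn
    have hR' : ∀ k, sqnorm (v - x k) ≤ R := fun k => hR ⟨x k, hle0 k, rfl⟩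
    have hR0 : 0 ≤ R := (sqnorm_nonneg _).trans (hR' 0)
    obtain ⟨C, hC⟩ : ∃ C, C = B / 2 * R + ε := ⟨_, rfl⟩
    have hC0 : 0 < C := by rw [hC]; positivity
    have hCε : ε ≤ C := by rw [hC]; linarith [mul_nonneg hB0.le hR0]
    obtain ⟨α, hα⟩ : ∃ α, α = ε / (2 * C) := ⟨_, rfl⟩
    have hα0 : 0 < α := by rw [hα]; positivity
    have hα1 : α ≤ 1 := by rw [hα, div_le_one (by positivity)]; linarith
    have hαC : α * C = ε / 2 := by rw [hα]; field_simp
    have hstep' : ∀ k, phi A b lam (x (k + 1)) ≤ phi A b lam (x k) - α * ε / 2 := by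
      intro k
      have h := descent_step A b lam (M k) hlam (x k) (x (k + 1)) v (hstep k) (hdescent k) α
        hα0.le hα1
      have h2 : M k / 2 * (α ^ 2 * sqnorm (v - x k)) ≤ α * (ε / 2) := by
        rw [← hαC]
        have t1 : M k / 2 * sqnorm (v - x k) ≤ B / 2 * R :=
          mul_le_mul (by linarith [hM1 k]) (hR' k) (sqnorm_nonneg _) (by linarith)
        have t2 : M k / 2 * sqnorm (v - x k) ≤ C := by linarith
        have t3 := mul_le_mul_of_nonneg_left t2 (sq_nonneg α)
        linarith
      have h3 : α * ε ≤ α * (phi A b lam (x k) - phi A b lam v) :=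
        mul_le_mul_of_nonneg_left (by linarith [hxsle k]) hα0.le
      linarith
    have hlin : ∀ k : ℕ, phi A b lam (x k) ≤ phi A b lam (x 0) - k * (α * ε / 2) := by
      intro k
      induction k with
      | zero => simp
      | succ k ih => push_cast; linarith [hstep' k]
    obtain ⟨N, hN⟩ := exists_nat_gt ((phi A b lam (x 0) - phi A b lam xs) / (α * ε / 2))
    rw [div_lt_iff₀ (by positivity)] at hN
    linarith [hlin N, hxsle N]
  refine ⟨xs, hopt, hxsK.2, fun k => ⟨hsparse k, ?_⟩⟩
  obtain ⟨r, hr⟩ : ∃ r, r = rhoMinus A ((supp xbar).card + 2 * st) := ⟨_, rfl⟩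
  have hrate : 1 / (4 * Gu * (rhoPlus A ((supp xbar).card + 2 * st) /
              rhoMinus A ((supp xbar).card + 2 * st))) = r / (4 * B) := by
    have h1 : rhoPlus A ((supp xbar).card + 2 * st) ≠ 0 := (lt_of_lt_of_le hrho hrle).ne'
    have h2 : Gu ≠ 0 := by positivity
    rw [hB, hr]
    field_simp
  rw [hrate]
  rw [← hr] at hrho hrle
  have hrB : r ≤ B := by
    refine hrle.trans ?_
    rw [hB]; nlinarith
  have hq0 : 0 ≤ 1 - r / (4 * B) := by
    rw [sub_nonneg, div_le_one (by positivity)]; linarith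
  have hcontr : ∀ k, phi A b lam (x (k + 1)) - phi A b lam xs ≤
      (1 - r / (4 * B)) * (phi A b lam (x k) - phi A b lam xs) := by
    intro k
    obtain ⟨α, hα⟩ : ∃ α, α = r / (2 * B) := ⟨_, rfl⟩
    have hα0 : 0 < α := by rw [hα]; positivity
    have hα1 : α ≤ 1 := by rw [hα, div_le_one (by positivity)]; linarith
    have h := descent_step A b lam (M k) hlam (x k) (x (k + 1)) xs (hstep k) (hdescent k) α
      hα0.le hα1
    have hs := grad_min_strong A b lam hlam xs (x k) hopt
    have hrs := rhoMinus_le A ((supp xbar).card + 2 * st) (x k - xs)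
      ((l0_sub_le2 (supp xbar) (x k) xs).trans (by
        have h1 := hsparse k
        have h2 : l0on (supp xbar)ᶜ xs ≤ st := hxsK.2
        omega))
    rw [← hr, sqnorm_sub_comm] at hrs
    have t1 : M k / 2 * (α ^ 2 * sqnorm (xs - x k)) ≤ B / 2 * (α ^ 2 * sqnorm (xs - x k)) :=
      mul_le_mul_of_nonneg_right (by linarith [hM1 k])
        (mul_nonneg (sq_nonneg _) (sqnorm_nonneg _))
    have e1 : B * α = r / 2 := by rw [hα]; field_simp
    have e2 : r / (4 * B) = α / 2 := by rw [hα]; field_simp; norm_num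
    have t2 : B / 2 * (α ^ 2 * sqnorm (xs - x k)) = α / 4 * (r * sqnorm (xs - x k)) := by
      calc _ = (B * α) * (α / 2 * sqnorm (xs - x k)) := by ring
        _ = _ := by rw [e1]; ring
    have t3 : α / 4 * (r * sqnorm (xs - x k)) ≤
        α / 4 * (2 * (phi A b lam (x k) - phi A b lam xs)) :=
      mul_le_mul_of_nonneg_left (by linarith) (by linarith)
    rw [e2]
    linarith
  induction k with
  | zero => simp
  | succ k ih =>
    refine (hcontr k).trans ?_
    rw [pow_succ']
    rw [mul_assoc]
    exact mul_le_mul_of_nonneg_left ih hq0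

end PGH
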